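/- Let D be a real m×d matrix with nonzero columns and mutual coherence μ(D) = max_{i≠j} |d_i^T d_j| / (‖d_i‖₂ ‖d_j‖₂). If μ(D) > 0, then spark(D) ≥ 1 + 1/μ(D), i.e., every nonzero vector z ∈ ℝ^d with D z = 0 has at least 1 + 1/μ(D) nonzero entries. -/

import Mathlib

/-- `‖x‖₀`: the number of nonzero entries of `x`. -/
noncomputable def l0 {d : ℕ} (x : Fin d → ℝ) : ℕ :=
  (Finset.univ.filter fun i => x i ≠ 0).card

/-- The ℓ₂ norm of the `i`-th column of `D`. -/
noncomputable def colNorm {m d : ℕ} (D : Matrix (Fin m) (Fin d) ℝ) (i : Fin d) : ℝ :=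
  Real.sqrt (∑ t, (D t i) ^ 2)

/-- The set of normalized absolute inner products between distinct columns of `D`;
its greatest element is the mutual coherence `μ(D)`. -/
def cohSet {m d : ℕ} (D : Matrix (Fin m) (Fin d) ℝ) : Set ℝ :=
  {r | ∃ i j : Fin d, i ≠ j ∧ r = |∑ t, D t i * D t j| / (colNorm D i * colNorm D j)}

lemma colNorm_sq {m d : ℕ} (D : Matrix (Fin m) (Fin d) ℝ) (i : Fin d) :
    colNorm D i ^ 2 = ∑ t, D t i * D t i := by
  rw [colNorm, Real.sq_sqrt (Finset.sum_nonneg fun t _ => sq_nonneg _)]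
  simp_rw [sq]

lemma colNorm_pos {m d : ℕ} {D : Matrix (Fin m) (Fin d) ℝ} {i : Fin d}
    (h : (fun t => D t i) ≠ 0) : 0 < colNorm D i := by
  obtain ⟨t, ht⟩ := Function.ne_iff.mp h
  exact Real.sqrt_pos.mpr <| Finset.sum_pos' (fun s _ => sq_nonneg _)
    ⟨t, Finset.mem_univ t, sq_pos_of_ne_zero ht⟩

lemma abs_inner_col_le {m d : ℕ} {D : Matrix (Fin m) (Fin d) ℝ}
    (hcols : ∀ i : Fin d, (fun t => D t i) ≠ 0) {μ : ℝ} (hμ : μ ∈ upperBounds (cohSet D))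
    {i j : Fin d} (hij : i ≠ j) :
    |∑ t, D t i * D t j| ≤ μ * (colNorm D i * colNorm D j) :=
  (div_le_iff₀ (mul_pos (colNorm_pos (hcols i)) (colNorm_pos (hcols j)))).mp
    (hμ ⟨i, j, hij, rfl⟩)

/-- The `i`-th row of the normal equations `Dᵀ D z = 0`. -/
lemma sum_inner_col_mul_eq_zero {m d : ℕ} {D : Matrix (Fin m) (Fin d) ℝ} {z : Fin d → ℝ}
    (hz : D.mulVec z = 0) (i : Fin d) : ∑ j, (∑ t, D t i * D t j) * z j = 0 := by
  simp_rw [Finset.sum_mul]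
  rw [Finset.sum_comm]
  refine Finset.sum_eq_zero fun t _ => ?_
  have ht : ∑ j, D t j * z j = 0 := congrFun hz t
  simp_rw [mul_assoc, ← Finset.mul_sum, ht, mul_zero]

/-- Coherence–spark bound: `spark(D) ≥ 1 + 1/μ(D)`, i.e. every nonzero kernel vector of `D`
has at least `1 + 1/μ(D)` nonzero entries. -/
theorem spark_ge_one_add_inv_coherence {m d : ℕ} (D : Matrix (Fin m) (Fin d) ℝ)
    (hcols : ∀ i : Fin d, (fun t => D t i) ≠ 0)
    (μ : ℝ) (hμ : IsGreatest (cohSet D) μ) (hpos : 0 < μ) :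
    ∀ z : Fin d → ℝ, z ≠ 0 → D.mulVec z = 0 → 1 + 1 / μ ≤ (l0 z : ℝ) := by
  intro z hz hDz
  obtain ⟨k, hk⟩ := Function.ne_iff.mp hz
  obtain ⟨i, -, hmax⟩ := Finset.exists_max_image Finset.univ
    (fun j => colNorm D j * |z j|) ⟨k, Finset.mem_univ k⟩
  have hw : 0 < colNorm D i * |z i| :=
    (mul_pos (colNorm_pos (hcols k)) (abs_pos.mpr hk)).trans_le (hmax k (Finset.mem_univ k))
  have hi := colNorm_pos (hcols i)
  have hzi : z i ≠ 0 := fun h => by simp [h] at hw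
  set S := Finset.univ.filter fun j => z j ≠ 0 with hS
  have hiS : i ∈ S := by simp [hS, hzi]
  have hsum : ∑ j ∈ S, (∑ t, D t i * D t j) * z j = 0 := by
    rw [← sum_inner_col_mul_eq_zero hDz i]
    exact Finset.sum_subset (Finset.subset_univ S) fun j _ hj => by
      have : z j = 0 := by simpa [hS] using hj
      simp [this]
  rw [← Finset.add_sum_erase S _ hiS, ← colNorm_sq] at hsum
  have hbound : colNorm D i * (colNorm D i * |z i|) ≤
      colNorm D i * (colNorm D i * |z i|) * (μ * ((S.card : ℝ) - 1)) :=
    calc colNorm D i * (colNorm D i * |z i|)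
        = |colNorm D i ^ 2 * z i| := by rw [abs_mul, abs_of_nonneg (sq_nonneg (colNorm D i))]; ring
      _ = |∑ j ∈ S.erase i, (∑ t, D t i * D t j) * z j| := by
          rw [eq_neg_of_add_eq_zero_left hsum, abs_neg]
      _ ≤ ∑ j ∈ S.erase i, |(∑ t, D t i * D t j) * z j| := Finset.abs_sum_le_sum_abs _ _
      _ ≤ ∑ _j ∈ S.erase i, μ * colNorm D i * (colNorm D i * |z i|) := by
          refine Finset.sum_le_sum fun j hj => ?_
          calc |(∑ t, D t i * D t j) * z j|
              ≤ μ * (colNorm D i * colNorm D j) * |z j| := by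
                rw [abs_mul]
                exact mul_le_mul_of_nonneg_right
                  (abs_inner_col_le hcols hμ.2 (Finset.ne_of_mem_erase hj).symm) (abs_nonneg _)
            _ = μ * colNorm D i * (colNorm D j * |z j|) := by ring
            _ ≤ μ * colNorm D i * (colNorm D i * |z i|) :=
                mul_le_mul_of_nonneg_left (hmax j (Finset.mem_univ j)) (mul_pos hpos hi).le
      _ = colNorm D i * (colNorm D i * |z i|) * (μ * ((S.card : ℝ) - 1)) := by
          rw [Finset.sum_const, nsmul_eq_mul, Finset.cast_card_erase_of_mem hiS]
          ring
  have hone : 1 ≤ ((S.card : ℝ) - 1) * μ := by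
    rw [mul_comm]
    exact (le_mul_iff_one_le_right (mul_pos hi hw)).mp hbound
  have hinv : 1 / μ ≤ (S.card : ℝ) - 1 := (div_le_iff₀ hpos).mpr hone
  change 1 + 1 / μ ≤ (S.card : ℝ)
  linarith
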